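/- arXiv:1210.3311 — 2 statements merged into one kernel-verified Lean document; each statement's English description precedes it below -/
import Mathlib

section
/- Let 0 < p < ∞ and let ω be a radial weight on the unit disc. Then there exists a constant C > 0, depending only on p and ω, such that for every analytic function f on 𝔻, ‖f‖^p_{A^p_ω} ≤ ∫_𝔻 N(f)(u)^p ω(u) dA(u) ≤ C ‖f‖^p_{A^p_ω}, where N(f)(u) = sup_{z ∈ Γ(u)} |f(z)| is the non-tangential maximal function. -/
open MeasureTheory Set Filter

noncomputable section

/-- `wInt ω r = ∫_r^1 ω(s) ds`. -/
def wInt (ω : ℝ → ℝ) (r : ℝ) : ℝ := ∫ s in r..1, ω s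

/-- A radial weight on the unit disc, identified with a function on `[0,1)`:
positive and integrable. -/
def IsRadialWeight (ω : ℝ → ℝ) : Prop :=
  (∀ r ∈ Set.Ico (0:ℝ) 1, 0 < ω r) ∧ IntegrableOn ω (Set.Ico (0:ℝ) 1)

/-- A radial continuous weight. -/
def IsRadialContinuousWeight (ω : ℝ → ℝ) : Prop :=
  IsRadialWeight ω ∧ ContinuousOn ω (Set.Ico (0:ℝ) 1)

/-- A regular weight: radial continuous with `ψ_ω(r) ≍ 1 - r`, i.e.
`(1-r)·ω(r) ≍ ∫_r^1 ω(s) ds` on `[0,1)`. -/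
def IsRegularWeight (ω : ℝ → ℝ) : Prop :=
  IsRadialContinuousWeight ω ∧ ∃ c C : ℝ, 0 < c ∧ 0 < C ∧
    ∀ r ∈ Set.Ico (0:ℝ) 1,
      c * ((1 - r) * ω r) ≤ wInt ω r ∧ wInt ω r ≤ C * ((1 - r) * ω r)

/-- A rapidly increasing weight: radial continuous with
`ψ_ω(r)/(1-r) = (∫_r^1 ω)/(ω(r)(1-r)) → ∞` as `r → 1⁻`. -/
def IsRapidlyIncreasing (ω : ℝ → ℝ) : Prop :=
  IsRadialContinuousWeight ω ∧
    Tendsto (fun r => wInt ω r / (ω r * (1 - r))) (nhdsWithin 1 (Set.Iio 1)) atTop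

/-- The open unit disc in `ℂ`. -/
def unitDisc : Set ℂ := {z : ℂ | ‖z‖ < 1}

/-- The non-tangential (lens type) region `Γ(u)` with vertex at `u = re^{iθ}`:
`{z ∈ 𝔻 : |θ - arg z| < (1 - |z|/r)/2}`. -/
def Gamma (u : ℂ) : Set ℂ :=
  {z : ℂ | z ∈ unitDisc ∧ |Complex.arg u - Complex.arg z| < (1 - ‖z‖ / ‖u‖) / 2}

/-- The non-tangential maximal function `N(f)(u) = sup_{z ∈ Γ(u)} |f(z)|`,
with values in `[0,∞]`. -/
def NTmax (f : ℂ → ℂ) (u : ℂ) : ENNReal := ⨆ z ∈ Gamma u, ENNReal.ofReal ‖f z‖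

/-- The uncentred Hardy–Littlewood maximal function on the line. -/
def hlMax (g : ℝ → ENNReal) (x : ℝ) : ENNReal :=
  ⨆ (b : ℝ × ℝ) (_ : 0 < b.2 ∧ x ∈ Metric.ball b.1 b.2),
    (∫⁻ y in Metric.ball b.1 b.2, g y) / ENNReal.ofReal (2 * b.2)

theorem lt_hlMax_iff {g : ℝ → ENNReal} {x : ℝ} {a : ENNReal} :
    a < hlMax g x ↔ ∃ b : ℝ × ℝ, (0 < b.2 ∧ x ∈ Metric.ball b.1 b.2) ∧
      a < (∫⁻ y in Metric.ball b.1 b.2, g y) / ENNReal.ofReal (2 * b.2) := by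
  simp only [hlMax, lt_iSup_iff, exists_prop]

theorem measurable_hlMax (g : ℝ → ENNReal) : Measurable (hlMax g) := by
  refine measurable_of_Ioi fun a => IsOpen.measurableSet ?_
  rw [isOpen_iff_mem_nhds]
  intro x hx
  obtain ⟨b, ⟨hb, hxb⟩, hlt⟩ := lt_hlMax_iff.1 (show a < hlMax g x from hx)
  filter_upwards [Metric.isOpen_ball.mem_nhds hxb] with y hy
  exact lt_hlMax_iff.2 ⟨b, ⟨hb, hy⟩, hlt⟩

theorem lintegral_ball_le_hlMax (g : ℝ → ENNReal) {c r x : ℝ} (hr : 0 < r)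
    (hx : x ∈ Metric.ball c r) :
    ∫⁻ y in Metric.ball c r, g y ≤ ENNReal.ofReal (2 * r) * hlMax g x := by
  have h : (∫⁻ y in Metric.ball c r, g y) / ENNReal.ofReal (2 * r) ≤ hlMax g x :=
    le_iSup₂_of_le (f := fun (b : ℝ × ℝ) (_ : 0 < b.2 ∧ x ∈ Metric.ball b.1 b.2) =>
      (∫⁻ y in Metric.ball b.1 b.2, g y) / ENNReal.ofReal (2 * b.2)) (c, r) ⟨hr, hx⟩ le_rfl
  rw [ENNReal.div_le_iff_le_mul (.inl (by simpa using hr)) (.inl ENNReal.ofReal_ne_top)] at h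
  rwa [mul_comm]

theorem hlMax_le_const {g : ℝ → ENNReal} {B : ENNReal} (hg : ∀ x, g x ≤ B) (x : ℝ) :
    hlMax g x ≤ B := by
  refine iSup₂_le fun b hb => ?_
  have := hb.1
  rw [ENNReal.div_le_iff_le_mul (.inl (by simpa using this)) (.inl ENNReal.ofReal_ne_top)]
  calc ∫⁻ y in Metric.ball b.1 b.2, g y ≤ ∫⁻ y in Metric.ball b.1 b.2, B :=
        lintegral_mono fun y => hg y
    _ = B * ENNReal.ofReal (2 * b.2) := by simp

theorem hlMax_le_add {g h : ℝ → ENNReal} {B : ENNReal} (hg : ∀ x, g x ≤ h x + B) (x : ℝ) :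
    hlMax g x ≤ hlMax h x + B := by
  refine iSup₂_le fun b hb => ?_
  have := hb.1
  rw [ENNReal.div_le_iff_le_mul (.inl (by simpa using this)) (.inl ENNReal.ofReal_ne_top)]
  calc ∫⁻ y in Metric.ball b.1 b.2, g y ≤ ∫⁻ y in Metric.ball b.1 b.2, (h y + B) :=
        lintegral_mono fun y => hg y
    _ = (∫⁻ y in Metric.ball b.1 b.2, h y) + B * ENNReal.ofReal (2 * b.2) := by
        rw [lintegral_add_right _ measurable_const]; simp
    _ ≤ (hlMax h x + B) * ENNReal.ofReal (2 * b.2) := by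
        rw [add_mul]; gcongr
        rw [mul_comm]; exact lintegral_ball_le_hlMax h hb.1 hb.2

/-- The weak type `(1,1)` inequality for the maximal function. -/
theorem mul_volume_lt_hlMax_le (g : ℝ → ENNReal) {t : ENNReal} (ht0 : t ≠ 0) (ht : t ≠ ⊤) :
    t * volume {x | t < hlMax g x} ≤ 5 * ∫⁻ y, g y := by
  by_cases hI : ∫⁻ y, g y = ⊤
  · simp [hI]
  let S : Set (ℝ × ℝ) := {b | 0 < b.2 ∧
    t * ENNReal.ofReal (2 * b.2) ≤ ∫⁻ y in Metric.closedBall b.1 b.2, g y}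
  have hR : ∀ b ∈ S, b.2 ≤ ((∫⁻ y, g y) / t).toReal := by
    intro b hb
    have h1 : ENNReal.ofReal (2 * b.2) ≤ (∫⁻ y, g y) / t := by
      rw [ENNReal.le_div_iff_mul_le (.inl ht0) (.inl ht), mul_comm]
      exact hb.2.trans (setLIntegral_le_lintegral _ _)
    have h2 := (ENNReal.ofReal_le_iff_le_toReal (ENNReal.div_ne_top hI ht0)).1 h1
    linarith [hb.1]
  obtain ⟨u, huS, hdisj, hcov⟩ := Vitali.exists_disjoint_subfamily_covering_enlargement_closedBall
    S Prod.fst Prod.snd _ hR 5 (by norm_num)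
  have hu : u.Countable := hdisj.countable_of_nonempty_interior fun b hb => by
    refine ⟨b.1, mem_interior_iff_mem_nhds.2 (Metric.closedBall_mem_nhds _ (huS hb).1)⟩
  have hsub : {x | t < hlMax g x} ⊆ ⋃ b ∈ u, Metric.closedBall b.1 (5 * b.2) := by
    intro x hx
    obtain ⟨b, ⟨hb, hxb⟩, hlt⟩ := lt_hlMax_iff.1 hx
    have hbS : b ∈ S := by
      refine ⟨hb, ?_⟩
      rw [ENNReal.lt_div_iff_mul_lt (.inl (by simpa using hb)) (.inl ENNReal.ofReal_ne_top)] at hlt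
      exact hlt.le.trans (lintegral_mono_set Metric.ball_subset_closedBall)
    obtain ⟨d, hd, hsub⟩ := hcov b hbS
    exact mem_biUnion hd (hsub (Metric.ball_subset_closedBall hxb))
  have := hu.to_subtype
  calc t * volume {x | t < hlMax g x}
      ≤ t * ∑' b : u, volume (Metric.closedBall b.1.1 (5 * b.1.2)) := by
        gcongr
        exact (measure_mono hsub).trans (measure_biUnion_le _ hu _)
    _ = ∑' b : u, 5 * (t * ENNReal.ofReal (2 * b.1.2)) := by
        rw [← ENNReal.tsum_mul_left]
        congr 1 with b
        rw [Real.volume_closedBall, show 2 * (5 * b.1.2) = 5 * (2 * b.1.2) by ring,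
          ENNReal.ofReal_mul (by norm_num)]
        simp only [ENNReal.ofReal_ofNat]
        ring
    _ ≤ ∑' b : u, 5 * ∫⁻ y in Metric.closedBall b.1.1 b.1.2, g y := by
        gcongr with b
        exact (huS b.2).2
    _ = 5 * ∫⁻ y in ⋃ b ∈ u, Metric.closedBall b.1 b.2, g y := by
        rw [ENNReal.tsum_mul_left, lintegral_biUnion hu (fun _ _ => measurableSet_closedBall) hdisj]
    _ ≤ 5 * ∫⁻ y, g y := by
        gcongr
        exact Measure.restrict_le_self

/-- The strong type `(2,2)` inequality for the maximal function. -/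
theorem lintegral_hlMax_sq_le {g : ℝ → ENNReal} (hg : Measurable g) {B : ENNReal} (hB : B ≠ ⊤)
    (hgB : ∀ x, g x ≤ B) :
    ∫⁻ x, hlMax g x ^ 2 ≤ 40 * ∫⁻ x, g x ^ 2 := by
  have hfin (x : ℝ) : hlMax g x ≠ ⊤ := ne_top_of_le_ne_top hB (hlMax_le_const hgB x)
  have hgfin (x : ℝ) : g x ≠ ⊤ := ne_top_of_le_ne_top hB (hgB x)
  have h1 := lintegral_rpow_eq_lintegral_meas_lt_mul volume (f := fun x => (hlMax g x).toReal)
    (.of_forall fun _ => ENNReal.toReal_nonneg) (measurable_hlMax g).ennreal_toReal.aemeasurable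
    two_pos
  have h2 (x : ℝ) : ENNReal.ofReal ((hlMax g x).toReal ^ (2 : ℝ)) = hlMax g x ^ 2 := by
    rw [Real.rpow_two, ENNReal.ofReal_pow ENNReal.toReal_nonneg, ENNReal.ofReal_toReal (hfin x)]
  simp only [h2] at h1
  have hmeas : MeasurableSet {q : ℝ × ℝ | ENNReal.ofReal (q.1 / 2) < g q.2} :=
    measurableSet_lt (by fun_prop) (by fun_prop)
  have key : ∀ t ∈ Ioi (0 : ℝ), volume {x | t < (hlMax g x).toReal} *
      ENNReal.ofReal (t ^ ((2 : ℝ) - 1)) ≤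
      10 * ∫⁻ y, {q : ℝ × ℝ | ENNReal.ofReal (q.1 / 2) < g q.2}.indicator
        (fun q => g q.2) (t, y) := by
    intro t ht
    have ht : 0 < t := ht
    set s := ENNReal.ofReal (t / 2) with hs
    set h : ℝ → ENNReal := fun y =>
      {q : ℝ × ℝ | ENNReal.ofReal (q.1 / 2) < g q.2}.indicator (fun q => g q.2) (t, y) with hh
    have hts : ENNReal.ofReal t = s + s := by
      rw [hs, ← ENNReal.ofReal_add (by positivity) (by positivity)]; ring_nf
    have hgh (x : ℝ) : g x ≤ h x + s := by
      by_cases hx : s < g x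
      · have : h x = g x := by simp [hh, ← hs, hx]
        rw [this]; exact le_self_add
      · exact (not_lt.1 hx).trans le_add_self
    have hsub : {x | t < (hlMax g x).toReal} ⊆ {x | s < hlMax h x} := by
      intro x hx
      have h3 : s + s < hlMax h x + s :=
        calc s + s = ENNReal.ofReal t := hts.symm
          _ < hlMax g x := (ENNReal.ofReal_lt_iff_lt_toReal ht.le (hfin x)).2 hx
          _ ≤ _ := hlMax_le_add hgh x
      exact lt_of_add_lt_add_right h3
    calc volume {x | t < (hlMax g x).toReal} * ENNReal.ofReal (t ^ ((2 : ℝ) - 1))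
        = 2 * (s * volume {x | t < (hlMax g x).toReal}) := by
          rw [show (2 : ℝ) - 1 = 1 by norm_num, Real.rpow_one, hts]; ring
      _ ≤ 2 * (5 * ∫⁻ y, h y) := by
          gcongr 2 * ?_
          refine le_trans ?_ (mul_volume_lt_hlMax_le h (t := s) ?_ ENNReal.ofReal_ne_top)
          · gcongr
          · simpa [hs] using ht
      _ = 10 * ∫⁻ y, h y := by rw [← mul_assoc]; norm_num
  have hswap : ∀ y, ∫⁻ t in Ioi (0 : ℝ), {q : ℝ × ℝ | ENNReal.ofReal (q.1 / 2) < g q.2}.indicator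
        (fun q => g q.2) (t, y) = 2 * g y ^ 2 := by
    intro y
    have : ∀ t ∈ Ioi (0 : ℝ), {q : ℝ × ℝ | ENNReal.ofReal (q.1 / 2) < g q.2}.indicator
        (fun q => g q.2) (t, y) = (Iio (2 * (g y).toReal)).indicator (fun _ => g y) t := by
      intro t ht
      have ht : 0 < t := ht
      have : ENNReal.ofReal (t / 2) < g y ↔ t < 2 * (g y).toReal := by
        rw [ENNReal.ofReal_lt_iff_lt_toReal (by positivity) (hgfin y)]
        constructor <;> intro <;> linarith
      simp [indicator, this]
    rw [setLIntegral_congr_fun measurableSet_Ioi this, lintegral_indicator measurableSet_Iio,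
      Measure.restrict_restrict measurableSet_Iio]
    simp only [lintegral_const, MeasurableSet.univ, Measure.restrict_apply, univ_inter]
    rw [show Iio (2 * (g y).toReal) ∩ Ioi 0 = Ioo 0 (2 * (g y).toReal) by
      ext; simp [and_comm], Real.volume_Ioo, sub_zero, ENNReal.ofReal_mul (by norm_num),
      ENNReal.ofReal_toReal (hgfin y)]
    simp only [ENNReal.ofReal_ofNat]
    ring
  rw [h1]
  calc ENNReal.ofReal 2 * ∫⁻ t in Ioi (0 : ℝ), volume {x | t < (hlMax g x).toReal} *
      ENNReal.ofReal (t ^ ((2 : ℝ) - 1))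
      ≤ ENNReal.ofReal 2 * ∫⁻ t in Ioi (0 : ℝ), 10 * ∫⁻ y,
        {q : ℝ × ℝ | ENNReal.ofReal (q.1 / 2) < g q.2}.indicator (fun q => g q.2) (t, y) := by
        gcongr 1
        exact setLIntegral_mono' measurableSet_Ioi key
    _ = 20 * ∫⁻ y, 2 * g y ^ 2 := by
        rw [lintegral_const_mul' _ _ (by norm_num), lintegral_lintegral_swap]
        · simp only [hswap]
          rw [← mul_assoc]; norm_num
        · exact (((hg.comp measurable_snd).indicator hmeas)).aemeasurable
    _ = 40 * ∫⁻ x, g x ^ 2 := by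
        rw [lintegral_const_mul' _ _ (by norm_num), ← mul_assoc]; norm_num

/-- Averages against the Cauchy (Poisson) kernel are controlled by the maximal function. -/
theorem lintegral_kernel_mul_le_hlMax {g : ℝ → ENNReal} (hg : Measurable g) {d : ℝ} (hd : 0 < d)
    (x : ℝ) :
    ∫⁻ t, ENNReal.ofReal (d / (d ^ 2 + (t - x) ^ 2)) * g t ≤ 16 * hlMax g x := by
  have hpt (t : ℝ) : ENNReal.ofReal (d / (d ^ 2 + (t - x) ^ 2)) * g t ≤
      ∑' k : ℕ, ENNReal.ofReal (4 / (4 ^ k * d)) *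
        (Metric.ball x (2 ^ k * d)).indicator g t := by
    have hex : ∃ k : ℕ, |t - x| < 2 ^ k * d := by
      obtain ⟨k, hk⟩ := pow_unbounded_of_one_lt (|t - x| / d) (one_lt_two)
      exact ⟨k, (div_lt_iff₀ hd).1 hk⟩
    classical
    obtain ⟨k, hk, hmin⟩ : ∃ k : ℕ, |t - x| < 2 ^ k * d ∧
        ∀ m < k, ¬ |t - x| < 2 ^ m * d :=
      ⟨Nat.find hex, Nat.find_spec hex, fun m hm => Nat.find_min hex hm⟩
    refine le_trans ?_ (ENNReal.le_tsum k)
    have hmem : t ∈ Metric.ball x (2 ^ k * d) := by simpa [Real.dist_eq] using hk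
    rw [indicator_of_mem hmem]
    gcongr ENNReal.ofReal ?_ * _
    rw [div_le_div_iff₀ (by positivity) (by positivity)]
    cases k with
    | zero => nlinarith [sq_nonneg (t - x)]
    | succ m =>
      have h1 := not_lt.1 (hmin m (Nat.lt_succ_self m))
      have h2 : (2 ^ m * d) ^ 2 ≤ (t - x) ^ 2 := by
        rw [← sq_abs (t - x)]; gcongr
      have h3 : (4 : ℝ) ^ m = (2 ^ m) ^ 2 := by
        rw [← pow_mul, mul_comm, pow_mul]; norm_num
      rw [pow_succ, h3]
      nlinarith [sq_nonneg d]
  have hsum : ∑' k : ℕ, ENNReal.ofReal (8 * (1 / 2) ^ k) = 16 := by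
    rw [← ENNReal.ofReal_tsum_of_nonneg (fun _ => by positivity)
      (summable_geometric_two.mul_left 8), tsum_mul_left, tsum_geometric_two]
    norm_num
  calc ∫⁻ t, ENNReal.ofReal (d / (d ^ 2 + (t - x) ^ 2)) * g t
      ≤ ∫⁻ t, ∑' k : ℕ, ENNReal.ofReal (4 / (4 ^ k * d)) *
        (Metric.ball x (2 ^ k * d)).indicator g t := lintegral_mono hpt
    _ = ∑' k : ℕ, ENNReal.ofReal (4 / (4 ^ k * d)) * ∫⁻ t in Metric.ball x (2 ^ k * d), g t := by
        rw [lintegral_tsum fun k => ((hg.indicator measurableSet_ball).const_mul _).aemeasurable]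
        congr 1 with k
        rw [lintegral_const_mul' _ _ ENNReal.ofReal_ne_top, lintegral_indicator measurableSet_ball]
    _ ≤ ∑' k : ℕ, ENNReal.ofReal (4 / (4 ^ k * d)) *
          (ENNReal.ofReal (2 * (2 ^ k * d)) * hlMax g x) := by
        gcongr with k
        exact lintegral_ball_le_hlMax g (by positivity) (Metric.mem_ball_self (by positivity))
    _ = ∑' k : ℕ, ENNReal.ofReal (8 * (1 / 2) ^ k) * hlMax g x := by
        congr 1 with k
        rw [← mul_assoc, ← ENNReal.ofReal_mul (by positivity)]
        congr 2
        have h3 : (4 : ℝ) ^ k = (2 ^ k) ^ 2 := by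
          rw [← pow_mul, mul_comm, pow_mul]; norm_num
        rw [h3, one_div, inv_pow]
        field_simp
        norm_num
    _ = 16 * hlMax g x := by rw [ENNReal.tsum_mul_right, hsum]

/-- Real continuous functions on a circle centred at the origin are uniformly approximated by real
parts of entire functions. -/
theorem exists_entire_re_approx {R : ℝ} (hR : 0 < R) {φ : ℂ → ℝ}
    (hφ : ContinuousOn φ (Metric.sphere 0 R)) {ε : ℝ} (hε : 0 < ε) :
    ∃ Q : ℂ → ℂ, Differentiable ℂ Q ∧ ∀ ζ ∈ Metric.sphere (0 : ℂ) R, |(Q ζ).re - φ ζ| < ε := by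
  have : Fact (0 < (1 : ℝ)) := ⟨one_pos⟩
  let Φ : C(AddCircle (1 : ℝ), ℂ) :=
    ⟨fun x => (φ (R * (AddCircle.toCircle x : ℂ)) : ℂ), by
      refine Complex.continuous_ofReal.comp (hφ.comp_continuous ?_ fun x => ?_)
      · exact continuous_const.mul (continuous_subtype_val.comp AddCircle.continuous_toCircle)
      · rw [mem_sphere_zero_iff_norm, norm_mul, Circle.norm_coe, mul_one, Complex.norm_real,
          Real.norm_of_nonneg hR.le]⟩
  have hmem : Φ ∈ (Submodule.span ℂ (range (@fourier 1))).topologicalClosure := by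
    rw [span_fourier_closure_eq_top]; trivial
  obtain ⟨g, hg, hgd⟩ := Metric.mem_closure_iff.1 hmem ε hε
  have hrep : ∃ P Q : ℂ → ℂ, Differentiable ℂ P ∧ Differentiable ℂ Q ∧ ∀ x : AddCircle (1 : ℝ),
      g x = P (AddCircle.toCircle x) + (starRingEnd ℂ) (Q (AddCircle.toCircle x)) := by
    refine Submodule.span_induction
      (p := fun (g : C(AddCircle (1 : ℝ), ℂ)) _ => ∃ P Q : ℂ → ℂ, Differentiable ℂ P ∧
        Differentiable ℂ Q ∧ ∀ x : AddCircle (1 : ℝ),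
        g x = P (AddCircle.toCircle x) + (starRingEnd ℂ) (Q (AddCircle.toCircle x)))
      ?_ ?_ ?_ ?_ hg
    · rintro _ ⟨n, rfl⟩
      obtain ⟨m, rfl | rfl⟩ := n.eq_nat_or_neg
      · refine ⟨fun z => z ^ m, fun _ => 0, by fun_prop, by fun_prop, fun x => ?_⟩
        simp [fourier_apply, AddCircle.toCircle_nsmul]
      · refine ⟨fun _ => 0, fun z => z ^ m, by fun_prop, by fun_prop, fun x => ?_⟩
        rw [fourier_neg]
        simp [fourier_apply, AddCircle.toCircle_nsmul]
    · exact ⟨fun _ => 0, fun _ => 0, by fun_prop, by fun_prop, by simp⟩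
    · rintro _ _ _ _ ⟨P, Q, hP, hQ, h⟩ ⟨P', Q', hP', hQ', h'⟩
      refine ⟨P + P', Q + Q', hP.add hP', hQ.add hQ', fun x => ?_⟩
      simp [h, h']; ring
    · rintro c _ _ ⟨P, Q, hP, hQ, h⟩
      refine ⟨c • P, (starRingEnd ℂ) c • Q, hP.const_smul _, hQ.const_smul _, fun x => ?_⟩
      simp [h]; ring
  obtain ⟨P, Q, hP, hQ, hPQ⟩ := hrep
  refine ⟨fun z => P (z / R) + Q (z / R), by fun_prop, fun ζ hζ => ?_⟩
  have hR' : (R : ℂ) ≠ 0 := by exact_mod_cast hR.ne'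
  have hζ' : ‖ζ‖ = R := by simpa using hζ
  obtain ⟨x, hx⟩ : ∃ x : AddCircle (1 : ℝ), (AddCircle.toCircle x : ℂ) = ζ / R := by
    obtain ⟨x, hx⟩ := (AddCircle.homeomorphCircle (T := 1) one_ne_zero).surjective
      ⟨ζ / R, by simp [Submonoid.unitSphere, hζ', abs_of_pos hR, hR.ne']⟩
    refine ⟨x, ?_⟩
    rw [AddCircle.homeomorphCircle_apply] at hx
    rw [hx]
  have h1 : (g x).re = (P (ζ / R) + Q (ζ / R)).re := by simp [hPQ, hx]
  have h2 : Φ x = (φ ζ : ℂ) := by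
    change (φ (R * (AddCircle.toCircle x : ℂ)) : ℂ) = _
    rw [hx, mul_div_cancel₀ _ hR']
  rw [← h1]
  calc |(g x).re - φ ζ| = |(Φ x - g x).re| := by
        rw [h2, abs_sub_comm]; simp
    _ ≤ ‖Φ x - g x‖ := Complex.abs_re_le_norm _
    _ = dist (Φ x) (g x) := (dist_eq_norm _ _).symm
    _ ≤ dist Φ g := ContinuousMap.dist_apply_le_dist x
    _ < ε := hgd

theorem poissonKernel_nonneg_of_mem_sphere {R : ℝ} {w z : ℂ} (hw : w ∈ Metric.ball 0 R)
    (hz : z ∈ Metric.sphere (0 : ℂ) R) : 0 ≤ poissonKernel 0 w z := by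
  rw [poissonKernel_def]
  have h1 : ‖w‖ < R := by simpa using hw
  have h2 : ‖z‖ = R := by simpa using hz
  have := norm_nonneg w
  simp only [sub_zero, h2]
  have : 0 ≤ R ^ 2 - ‖w‖ ^ 2 := by nlinarith
  positivity

theorem continuousOn_poissonKernel_sphere {R : ℝ} {w : ℂ} (hw : w ∈ Metric.ball 0 R) :
    ContinuousOn (poissonKernel 0 w) (Metric.sphere 0 R) := by
  have hR : 0 < R := Metric.pos_of_mem_ball hw
  rw [poissonKernel_eq_re_herglotzRieszKernel]
  have := continuousOn_herglotzRieszKernel_sphere hw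
  rw [abs_of_pos hR] at this
  exact Complex.continuous_re.comp_continuousOn this

/-- Modulus version of the Poisson formula. -/
theorem norm_le_circleAverage_poissonKernel {R : ℝ} {k : ℂ → ℂ}
    (hk : DiffContOnCl ℂ k (Metric.ball 0 R)) {w : ℂ} (hw : w ∈ Metric.ball 0 R) {u : ℂ → ℝ}
    (hu : ContinuousOn u (Metric.sphere 0 R)) (hku : ∀ ζ ∈ Metric.sphere (0 : ℂ) R, ‖k ζ‖ ≤ u ζ) :
    ‖k w‖ ≤ Real.circleAverage (fun ζ => poissonKernel 0 w ζ * u ζ) 0 R := by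
  have hR : 0 < R := Metric.pos_of_mem_ball hw
  rw [← hk.circleAverage_poissonKernel_smul hw]
  have hmem (t : ℝ) : circleMap 0 R t ∈ Metric.sphere (0 : ℂ) R := circleMap_mem_sphere 0 hR.le t
  have hkey (t : ℝ) : ‖poissonKernel 0 w (circleMap 0 R t) • k (circleMap 0 R t)‖ ≤
      poissonKernel 0 w (circleMap 0 R t) * u (circleMap 0 R t) := by
    rw [norm_smul, Real.norm_of_nonneg (poissonKernel_nonneg_of_mem_sphere hw (hmem t))]
    exact mul_le_mul_of_nonneg_left (hku _ (hmem t))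
      (poissonKernel_nonneg_of_mem_sphere hw (hmem t))
  have hint : IntervalIntegrable
      (fun t => poissonKernel 0 w (circleMap 0 R t) * u (circleMap 0 R t)) volume 0
        (2 * Real.pi) :=
    Continuous.intervalIntegrable
      (((continuousOn_poissonKernel_sphere hw).mul hu).comp_continuous
        (continuous_circleMap 0 R) hmem) _ _
  rw [Real.circleAverage, Real.circleAverage, norm_smul, smul_eq_mul, norm_inv,
    Real.norm_of_nonneg Real.two_pi_pos.le]
  gcongr
  exact intervalIntegral.norm_integral_le_of_norm_le Real.two_pi_pos.le
    (.of_forall fun t _ => hkey t) hint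

/-- For analytic `f` and `q > 0`, `|f| ^ q` is dominated by the Poisson integral of its boundary
values. -/
theorem norm_rpow_le_circleAverage_poissonKernel {R : ℝ} {f : ℂ → ℂ}
    (hf : DiffContOnCl ℂ f (Metric.ball 0 R)) {w : ℂ} (hw : w ∈ Metric.ball 0 R) {q : ℝ}
    (hq : 0 < q) :
    ‖f w‖ ^ q ≤ Real.circleAverage (fun ζ => poissonKernel 0 w ζ * ‖f ζ‖ ^ q) 0 R := by
  have hR : 0 < R := Metric.pos_of_mem_ball hw
  have hfc : ContinuousOn f (Metric.sphere 0 R) :=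
    hf.continuousOn_ball.mono Metric.sphere_subset_closedBall
  have hfq : ContinuousOn (fun ζ => ‖f ζ‖ ^ q) (Metric.sphere 0 R) :=
    hfc.norm.rpow_const fun _ _ => .inr hq.le
  have hmem (t : ℝ) : circleMap 0 R t ∈ Metric.sphere (0 : ℂ) R := circleMap_mem_sphere 0 hR.le t
  have hPint (u : ℂ → ℝ) (hu : ContinuousOn u (Metric.sphere 0 R)) :
      CircleIntegrable (fun ζ => poissonKernel 0 w ζ * u ζ) 0 R :=
    ((continuousOn_poissonKernel_sphere hw).mul hu).circleIntegrable hR.le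
  have hone : Real.circleAverage (fun ζ => poissonKernel 0 w ζ * 1) 0 R = 1 := by
    have := (InnerProductSpace.harmonicOnNhd_const (s := Metric.closedBall (0 : ℂ) R)
      (1 : ℝ)).circleAverage_poissonKernel_smul hw
    exact this
  have step : ∀ η > 0, ‖f w‖ ^ q ≤ Real.exp (2 * q * η) *
      (Real.circleAverage (fun ζ => poissonKernel 0 w ζ * ‖f ζ‖ ^ q) 0 R + η) := by
    intro η hη
    have hpos (ζ : ℂ) : 0 < ‖f ζ‖ ^ q + η := by positivity
    obtain ⟨Q, hQ, hQφ⟩ := exists_entire_re_approx hR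
      (φ := fun ζ => Real.log (‖f ζ‖ ^ q + η) / q + η)
      (((hfq.add continuousOn_const).log fun ζ _ => (hpos ζ).ne').div_const q |>.add
        continuousOn_const) hη
    have hle : ∀ ζ ∈ Metric.sphere (0 : ℂ) R, ‖f ζ * Complex.exp (-Q ζ)‖ ≤ 1 := by
      intro ζ hζ
      have h1 : Real.log (‖f ζ‖ ^ q + η) / q ≤ (Q ζ).re := by
        linarith [(abs_lt.1 (hQφ ζ hζ)).1]
      have h2 : ‖f ζ‖ ^ q ≤ Real.exp (Q ζ).re ^ q := by
        rw [← Real.exp_mul]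
        rw [div_le_iff₀ hq, Real.log_le_iff_le_exp (hpos ζ)] at h1
        linarith
      have h3 : ‖f ζ‖ ≤ Real.exp (Q ζ).re :=
        (Real.rpow_le_rpow_iff (norm_nonneg _) (Real.exp_pos _).le hq).1 h2
      rw [norm_mul, Complex.norm_exp, Complex.neg_re, Real.exp_neg, ← div_eq_mul_inv]
      exact (div_le_one (Real.exp_pos _)).2 h3
    have hmax : ‖f w * Complex.exp (-Q w)‖ ≤ 1 := by
      refine Complex.norm_le_of_forall_mem_frontier_norm_le
        (f := fun z => f z * Complex.exp (-Q z)) Metric.isBounded_ball ?_ ?_ (subset_closure hw)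
      · have : Differentiable ℂ fun z => Complex.exp (-Q z) := by fun_prop
        exact hf.smul this.diffContOnCl
      · rw [frontier_ball _ hR.ne']; exact hle
    have hfw : ‖f w‖ ≤ Real.exp (Q w).re := by
      rw [norm_mul, Complex.norm_exp, Complex.neg_re, Real.exp_neg, ← div_eq_mul_inv] at hmax
      exact (div_le_one (Real.exp_pos _)).1 hmax
    have hnorm (z : ℂ) : ‖Complex.exp (q * Q z)‖ = Real.exp (Q z).re ^ q := by
      rw [Complex.norm_exp, ← Real.exp_mul, Complex.re_ofReal_mul, mul_comm]
    have hdiff : Differentiable ℂ fun z => Complex.exp (q * Q z) := by fun_prop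
    have hb : ∀ ζ ∈ Metric.sphere (0 : ℂ) R, ‖Complex.exp (q * Q ζ)‖ ≤
        Real.exp (2 * q * η) * (‖f ζ‖ ^ q + η * 1) := by
      intro ζ hζ
      have h1 : (Q ζ).re ≤ Real.log (‖f ζ‖ ^ q + η) / q + 2 * η := by
        linarith [(abs_lt.1 (hQφ ζ hζ)).2]
      rw [hnorm, ← Real.exp_mul, mul_one]
      calc Real.exp ((Q ζ).re * q)
          ≤ Real.exp (2 * q * η + Real.log (‖f ζ‖ ^ q + η)) := by
            gcongr
            calc (Q ζ).re * q ≤ (Real.log (‖f ζ‖ ^ q + η) / q + 2 * η) * q := by gcongr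
              _ = _ := by field_simp; ring
        _ = _ := by rw [Real.exp_add, Real.exp_log (hpos ζ)]
    calc ‖f w‖ ^ q ≤ Real.exp (Q w).re ^ q := by gcongr
      _ = ‖Complex.exp (q * Q w)‖ := (hnorm w).symm
      _ ≤ Real.circleAverage (fun ζ => poissonKernel 0 w ζ *
            (Real.exp (2 * q * η) * (‖f ζ‖ ^ q + η * 1))) 0 R :=
          norm_le_circleAverage_poissonKernel hdiff.diffContOnCl hw
            (continuousOn_const.mul (hfq.add continuousOn_const)) hb
      _ = Real.exp (2 * q * η) *
          (Real.circleAverage (fun ζ => poissonKernel 0 w ζ * ‖f ζ‖ ^ q) 0 R + η) := by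
          have h1 : (fun ζ => poissonKernel 0 w ζ *
              (Real.exp (2 * q * η) * (‖f ζ‖ ^ q + η * 1))) = Real.exp (2 * q * η) •
              ((fun ζ => poissonKernel 0 w ζ * ‖f ζ‖ ^ q) +
                η • (fun ζ => poissonKernel 0 w ζ * 1)) := by
            ext ζ; simp; ring
          rw [h1, Real.circleAverage_smul, Real.circleAverage_add (hPint _ hfq)
            ((hPint _ continuousOn_const).const_smul), Real.circleAverage_smul, hone]
          simp
  set A := Real.circleAverage (fun ζ => poissonKernel 0 w ζ * ‖f ζ‖ ^ q) 0 R
  have hcont : Continuous fun η : ℝ => Real.exp (2 * q * η) * (A + η) := by fun_prop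
  have hlim : Tendsto (fun η : ℝ => Real.exp (2 * q * η) * (A + η)) (nhdsWithin 0 (Ioi 0))
      (nhds A) := by
    have := (hcont.tendsto 0).mono_left (nhdsWithin_le_nhds (s := Ioi 0))
    simpa using this
  exact ge_of_tendsto hlim (by filter_upwards [self_mem_nhdsWithin] with η hη using step η hη)

theorem norm_circleMap_sub_sq (R t : ℝ) (z : ℂ) :
    ‖circleMap 0 R t - z‖ ^ 2 =
      (R - ‖z‖) ^ 2 + 4 * R * ‖z‖ * Real.sin ((t - Complex.arg z) / 2) ^ 2 := by
  have hre : (circleMap 0 R t).re = R * Real.cos t := by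
    simp [circleMap_zero, Complex.exp_ofReal_mul_I_re]
  have him : (circleMap 0 R t).im = R * Real.sin t := by
    simp [circleMap_zero, Complex.exp_ofReal_mul_I_im]
  have hc : Real.cos (t - Complex.arg z) =
      1 - 2 * Real.sin ((t - Complex.arg z) / 2) ^ 2 := by
    rw [Real.sin_sq_eq_half_sub, mul_div_cancel₀ _ (two_ne_zero' ℝ)]; ring
  have hzr : z.re = ‖z‖ * Real.cos (Complex.arg z) := (Complex.norm_mul_cos_arg z).symm
  have hzi : z.im = ‖z‖ * Real.sin (Complex.arg z) := (Complex.norm_mul_sin_arg z).symm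
  rw [← Complex.normSq_eq_norm_sq, Complex.normSq_apply, Complex.sub_re, Complex.sub_im, hre, him,
    hzr, hzi]
  rw [Real.cos_sub] at hc
  linear_combination (-2 * R * ‖z‖) * hc + R ^ 2 * Real.sin_sq_add_cos_sq t +
    ‖z‖ ^ 2 * Real.sin_sq_add_cos_sq (Complex.arg z)

/-- On the non-tangential region the Poisson kernel is dominated by a Cauchy kernel centred at the
vertex. -/
theorem poissonKernel_circleMap_le {R t θ : ℝ} {z : ℂ} (hz : ‖z‖ < R)
    (ht : |t - Complex.arg z| ≤ Real.pi)
    (hθ : |θ - Complex.arg z| < (1 - ‖z‖ / R) / 2) :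
    poissonKernel 0 z (circleMap 0 R t) ≤
      164 * ((1 - ‖z‖ / R) / ((1 - ‖z‖ / R) ^ 2 + (t - θ) ^ 2)) := by
  have hR : 0 < R := (norm_nonneg z).trans_lt hz
  obtain ⟨a, ha⟩ : ∃ a, a = ‖z‖ / R := ⟨_, rfl⟩
  have hzR : ‖z‖ = a * R := by rw [ha]; field_simp
  have ha0 : 0 ≤ a := by rw [ha]; positivity
  have ha1 : a < 1 := by rw [ha]; exact (div_lt_one hR).2 hz
  have hd : 0 < 1 - a := by linarith
  obtain ⟨s, hs⟩ : ∃ s, s = t - Complex.arg z := ⟨_, rfl⟩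
  obtain ⟨v, hv⟩ : ∃ v, v = Real.sin (s / 2) ^ 2 := ⟨_, rfl⟩
  rw [← ha] at hθ ⊢
  rw [← hs] at ht
  have hv0 : 0 ≤ v := hv ▸ sq_nonneg _
  have hsin : s ^ 2 ≤ 10 * v := by
    have h1 : 2 / Real.pi * (|s| / 2) ≤ Real.sin (|s| / 2) :=
      Real.mul_le_sin (by positivity) (by linarith)
    have h2 : Real.sin (|s| / 2) ^ 2 = v := by
      rw [hv]
      rcases abs_cases s with ⟨h, _⟩ | ⟨h, _⟩
      · rw [h]
      · rw [h, neg_div, Real.sin_neg, neg_sq]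
    have h3 : |s| ≤ Real.pi * Real.sin (|s| / 2) := by
      calc |s| = Real.pi * (2 / Real.pi * (|s| / 2)) := by field_simp
        _ ≤ _ := by gcongr
    calc s ^ 2 = |s| ^ 2 := (sq_abs s).symm
      _ ≤ (Real.pi * Real.sin (|s| / 2)) ^ 2 := by gcongr
      _ = Real.pi ^ 2 * v := by rw [mul_pow, h2]
      _ ≤ 10 * v := by
        gcongr
        nlinarith [Real.pi_lt_d2, Real.pi_pos]
  have hs10 : s ^ 2 ≤ 10 := by
    calc s ^ 2 = |s| ^ 2 := (sq_abs s).symm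
      _ ≤ Real.pi ^ 2 := by gcongr
      _ ≤ 10 := by nlinarith [Real.pi_lt_d2, Real.pi_pos]
  have hD : (1 - a) ^ 2 + s ^ 2 ≤ 41 * ((1 - a) ^ 2 + 4 * a * v) := by
    rcases le_total (1 / 2) a with h | h
    · nlinarith [sq_nonneg (1 - a), mul_nonneg (sub_nonneg.2 h) hv0]
    · nlinarith [mul_nonneg ha0 hv0]
  have htθ : (1 - a) ^ 2 + (t - θ) ^ 2 ≤ 2 * ((1 - a) ^ 2 + s ^ 2) := by
    obtain ⟨h1, h2⟩ := abs_lt.1 hθ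
    have h3 : (θ - Complex.arg z) ^ 2 ≤ ((1 - a) / 2) ^ 2 := sq_le_sq' h1.le h2.le
    have h4 : t - θ = s - (θ - Complex.arg z) := by rw [hs]; ring
    rw [h4]
    nlinarith [sq_nonneg (s + (θ - Complex.arg z)), sq_nonneg (1 - a)]
  have hDpos : 0 < (1 - a) ^ 2 + 4 * a * v := by positivity
  have hP : poissonKernel 0 z (circleMap 0 R t) = (1 - a ^ 2) / ((1 - a) ^ 2 + 4 * a * v) := by
    rw [poissonKernel_def, sub_zero, sub_zero, norm_circleMap_sub_sq, ← hs, ← hv, hzR,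
      norm_circleMap_zero, abs_of_pos hR,
      show R ^ 2 - (a * R) ^ 2 = R ^ 2 * (1 - a ^ 2) by ring,
      show (R - a * R) ^ 2 + 4 * R * (a * R) * v = R ^ 2 * ((1 - a) ^ 2 + 4 * a * v) by ring,
      mul_div_mul_left _ _ (by positivity)]
  rw [hP, ← mul_div_assoc, div_le_div_iff₀ hDpos (by positivity)]
  calc (1 - a ^ 2) * ((1 - a) ^ 2 + (t - θ) ^ 2)
      ≤ (2 * (1 - a)) * (82 * ((1 - a) ^ 2 + 4 * a * v)) := by
        gcongr
        · nlinarith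
        · linarith
    _ = _ := by ring

/-- Inside a non-tangential region with vertex `R * exp (i θ)`, `|f| ^ q` is dominated by the maximal
function of its boundary values on the circle of radius `R`. -/
theorem ofReal_norm_rpow_le_hlMax {R θ q : ℝ} {f : ℂ → ℂ} {z : ℂ}
    (hf : DiffContOnCl ℂ f (Metric.ball 0 R)) (hq : 0 < q) (hz : ‖z‖ < R)
    (hθ : |θ - Complex.arg z| < (1 - ‖z‖ / R) / 2) :
    ENNReal.ofReal (‖f z‖ ^ q) ≤ 2624 * hlMax ((Icc (-(2 * Real.pi)) (2 * Real.pi)).indicator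
      fun t => ENNReal.ofReal (‖f (circleMap 0 R t)‖ ^ q)) θ := by
  have hR : 0 < R := (norm_nonneg z).trans_lt hz
  have hw : z ∈ Metric.ball (0 : ℂ) R := by simpa using hz
  have hmem (t : ℝ) : circleMap 0 R t ∈ Metric.sphere (0 : ℂ) R := circleMap_mem_sphere 0 hR.le t
  have hfc : Continuous fun t => ‖f (circleMap 0 R t)‖ ^ q :=
    ((hf.continuousOn_ball.mono Metric.sphere_subset_closedBall).comp_continuous
      (continuous_circleMap 0 R) hmem).norm.rpow_const fun _ => .inr hq.le
  have hPc : Continuous fun t => poissonKernel 0 z (circleMap 0 R t) :=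
    (continuousOn_poissonKernel_sphere hw).comp_continuous (continuous_circleMap 0 R) hmem
  have hπ := Real.pi_pos
  set F : ℝ → ℝ := fun t => poissonKernel 0 z (circleMap 0 R t) * ‖f (circleMap 0 R t)‖ ^ q with hF
  have hF0 (t : ℝ) : 0 ≤ F t :=
    mul_nonneg (poissonKernel_nonneg_of_mem_sphere hw (hmem t)) (by positivity)
  set φ := Complex.arg z with hφ
  set g : ℝ → ENNReal := (Icc (-(2 * Real.pi)) (2 * Real.pi)).indicator
      fun t => ENNReal.ofReal (‖f (circleMap 0 R t)‖ ^ q) with hg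
  have havg : ‖f z‖ ^ q ≤ ∫ t in Ioc (φ - Real.pi) (φ + Real.pi), F t := by
    refine (norm_rpow_le_circleAverage_poissonKernel hf hw hq).trans ?_
    rw [Real.circleAverage_eq_integral_add (φ - Real.pi),
      intervalIntegral.integral_comp_add_right F, smul_eq_mul, zero_add,
      show 2 * Real.pi + (φ - Real.pi) = φ + Real.pi by ring,
      intervalIntegral.integral_of_le (by linarith)]
    refine mul_le_of_le_one_left (integral_nonneg hF0) (inv_le_one_of_one_le₀ ?_)
    linarith [Real.pi_gt_three]
  have hd : 0 < 1 - ‖z‖ / R := sub_pos.2 ((div_lt_one hR).2 hz)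
  have hgm : Measurable g := hfc.measurable.ennreal_ofReal.indicator measurableSet_Icc
  calc ENNReal.ofReal (‖f z‖ ^ q)
      ≤ ENNReal.ofReal (∫ t in Ioc (φ - Real.pi) (φ + Real.pi), F t) :=
        ENNReal.ofReal_le_ofReal havg
    _ = ∫⁻ t in Ioc (φ - Real.pi) (φ + Real.pi), ENNReal.ofReal (F t) :=
        ofReal_integral_eq_lintegral_ofReal (hPc.mul hfc).integrableOn_Ioc (.of_forall hF0)
    _ ≤ ∫⁻ t in Ioc (φ - Real.pi) (φ + Real.pi),
          164 * (ENNReal.ofReal ((1 - ‖z‖ / R) / ((1 - ‖z‖ / R) ^ 2 + (t - θ) ^ 2)) * g t) := by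
        refine setLIntegral_mono' measurableSet_Ioc fun t ht => ?_
        have h1 := Complex.arg_le_pi z
        have h2 := Complex.neg_pi_lt_arg z
        have ht' : t ∈ Icc (-(2 * Real.pi)) (2 * Real.pi) :=
          ⟨by linarith [ht.1], by linarith [ht.2]⟩
        rw [hg, indicator_of_mem ht', hF, ENNReal.ofReal_mul
          (poissonKernel_nonneg_of_mem_sphere hw (hmem t)), ← mul_assoc]
        gcongr
        rw [show (164 : ENNReal) = ENNReal.ofReal 164 by simp, ← ENNReal.ofReal_mul (by norm_num)]
        refine ENNReal.ofReal_le_ofReal (poissonKernel_circleMap_le hz ?_ hθ)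
        rw [abs_le]
        exact ⟨by linarith [ht.1], by linarith [ht.2]⟩
    _ ≤ ∫⁻ t, 164 * (ENNReal.ofReal ((1 - ‖z‖ / R) / ((1 - ‖z‖ / R) ^ 2 + (t - θ) ^ 2)) * g t) :=
        setLIntegral_le_lintegral _ _
    _ = 164 * ∫⁻ t, ENNReal.ofReal ((1 - ‖z‖ / R) / ((1 - ‖z‖ / R) ^ 2 + (t - θ) ^ 2)) * g t :=
        lintegral_const_mul' _ _ (by norm_num)
    _ ≤ 164 * (16 * hlMax g θ) := by
        gcongr
        exact lintegral_kernel_mul_le_hlMax hgm hd θ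
    _ = 2624 * hlMax g θ := by rw [← mul_assoc]; norm_num

theorem lintegral_Icc_two_periods {h : ℝ → ℝ} (hc : Continuous h) (h0 : ∀ t, 0 ≤ h t)
    (hp : Function.Periodic h (2 * Real.pi)) :
    ∫⁻ t in Icc (-(2 * Real.pi)) (2 * Real.pi), ENNReal.ofReal (h t) =
      2 * ∫⁻ t in Ioo (-Real.pi) Real.pi, ENNReal.ofReal (h t) := by
  have hπ := Real.pi_pos
  have key (a b : ℝ) (hab : a ≤ b) :
      ∫⁻ t in Ioc a b, ENNReal.ofReal (h t) = ENNReal.ofReal (∫ t in a..b, h t) := by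
    rw [intervalIntegral.integral_of_le hab]
    exact (ofReal_integral_eq_lintegral_ofReal hc.integrableOn_Ioc (.of_forall h0)).symm
  rw [setLIntegral_congr Ioc_ae_eq_Icc.symm, setLIntegral_congr Ioo_ae_eq_Ioc,
    key _ _ (by linarith), key _ _ (by linarith),
    ← intervalIntegral.integral_add_adjacent_intervals (b := 0) (hc.intervalIntegrable _ _)
      (hc.intervalIntegrable _ _)]
  have h1 := hp.intervalIntegral_add_eq (-(2 * Real.pi)) (-Real.pi)
  have h2 := hp.intervalIntegral_add_eq 0 (-Real.pi)
  rw [show -(2 * Real.pi) + 2 * Real.pi = 0 by ring,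
    show -Real.pi + 2 * Real.pi = Real.pi by ring] at h1
  rw [zero_add, show -Real.pi + 2 * Real.pi = Real.pi by ring] at h2
  rw [h1, h2, ← two_mul, ENNReal.ofReal_mul (by norm_num), ENNReal.ofReal_ofNat]

/-- The Hardy–Littlewood non-tangential maximal theorem on the circle of radius `R < 1`. -/
theorem lintegral_NTmax_circle_le {p R : ℝ} (hp : 0 < p) (hR : 0 < R) (hR1 : R < 1) {f : ℂ → ℂ}
    (hf : DifferentiableOn ℂ f unitDisc) :
    ∫⁻ θ in Ioo (-Real.pi) Real.pi, NTmax f (circleMap 0 R θ) ^ p ≤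
      ENNReal.ofReal (2624 ^ 2 * 80) *
        ∫⁻ θ in Ioo (-Real.pi) Real.pi, ENNReal.ofReal (‖f (circleMap 0 R θ)‖ ^ p) := by
  have hsub : Metric.closedBall (0 : ℂ) R ⊆ unitDisc := fun z hz =>
    (mem_closedBall_zero_iff.1 hz).trans_lt hR1
  have hfd : DiffContOnCl ℂ f (Metric.ball 0 R) :=
    DifferentiableOn.diffContOnCl (hf.mono (by rwa [closure_ball _ hR.ne']))
  have hq : 0 < p / 2 := by positivity
  have hmem (t : ℝ) : circleMap 0 R t ∈ Metric.sphere (0 : ℂ) R := circleMap_mem_sphere 0 hR.le t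
  have hfs : Continuous fun t => f (circleMap 0 R t) :=
    (hfd.continuousOn_ball.mono Metric.sphere_subset_closedBall).comp_continuous
      (continuous_circleMap 0 R) hmem
  have hfc : Continuous fun t => ‖f (circleMap 0 R t)‖ ^ (p / 2) :=
    hfs.norm.rpow_const fun _ => .inr hq.le
  have hfp : Continuous fun t => ‖f (circleMap 0 R t)‖ ^ p :=
    hfs.norm.rpow_const fun _ => .inr hp.le
  set g : ℝ → ENNReal := (Icc (-(2 * Real.pi)) (2 * Real.pi)).indicator
      fun t => ENNReal.ofReal (‖f (circleMap 0 R t)‖ ^ (p / 2)) with hg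
  have hgm : Measurable g := hfc.measurable.ennreal_ofReal.indicator measurableSet_Icc
  obtain ⟨B, hB⟩ : ∃ B : ℝ, ∀ t, g t ≤ ENNReal.ofReal B := by
    obtain ⟨B, hB⟩ := isCompact_Icc.bddAbove_image
      (hfc.continuousOn (s := Icc (-(2 * Real.pi)) (2 * Real.pi)))
    refine ⟨B, fun t => ?_⟩
    by_cases ht : t ∈ Icc (-(2 * Real.pi)) (2 * Real.pi)
    · rw [hg, indicator_of_mem ht]
      exact ENNReal.ofReal_le_ofReal (hB (mem_image_of_mem _ ht))
    · rw [hg, indicator_of_notMem ht]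
      exact zero_le
  have hpt : ∀ θ ∈ Ioo (-Real.pi) Real.pi,
      NTmax f (circleMap 0 R θ) ^ p ≤ 2624 ^ 2 * hlMax g θ ^ 2 := by
    intro θ hθ
    have harg : Complex.arg (circleMap 0 R θ) = θ := by
      rw [circleMap_zero, Complex.arg_real_mul _ hR, Complex.exp_mul_I]
      exact Complex.arg_cos_add_sin_mul_I ⟨hθ.1, hθ.2.le⟩
    have hnorm : ‖circleMap 0 R θ‖ = R := by rw [norm_circleMap_zero, abs_of_pos hR]
    have h1 : NTmax f (circleMap 0 R θ) ≤ (2624 * hlMax g θ) ^ (p / 2)⁻¹ := by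
      refine iSup₂_le fun z hz => ?_
      have hz2 := hz.2
      rw [harg, hnorm] at hz2
      have hzR : ‖z‖ < R := by
        rw [← div_lt_one hR]
        linarith [abs_nonneg (θ - Complex.arg z)]
      rw [ENNReal.le_rpow_inv_iff hq,
        ENNReal.ofReal_rpow_of_nonneg (norm_nonneg _) hq.le]
      exact ofReal_norm_rpow_le_hlMax hfd hq hzR hz2
    rw [ENNReal.le_rpow_inv_iff hq] at h1
    calc NTmax f (circleMap 0 R θ) ^ p = (NTmax f (circleMap 0 R θ) ^ (p / 2)) ^ 2 := by
          rw [← ENNReal.rpow_two, ← ENNReal.rpow_mul]; ring_nf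
      _ ≤ (2624 * hlMax g θ) ^ 2 := by gcongr
      _ = _ := mul_pow _ _ _
  have hg2 : ∫⁻ t, g t ^ 2 =
      2 * ∫⁻ t in Ioo (-Real.pi) Real.pi, ENNReal.ofReal (‖f (circleMap 0 R t)‖ ^ p) := by
    rw [← lintegral_Icc_two_periods hfp (fun _ => by positivity)
      fun t => by simp only [periodic_circleMap 0 R t], ← lintegral_indicator measurableSet_Icc]
    congr 1 with t
    by_cases ht : t ∈ Icc (-(2 * Real.pi)) (2 * Real.pi)
    · rw [hg, indicator_of_mem ht, indicator_of_mem ht, ← ENNReal.ofReal_pow (by positivity),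
        ← Real.rpow_mul_natCast (norm_nonneg _)]
      norm_num
    · rw [hg, indicator_of_notMem ht, indicator_of_notMem ht]; norm_num
  calc ∫⁻ θ in Ioo (-Real.pi) Real.pi, NTmax f (circleMap 0 R θ) ^ p
      ≤ ∫⁻ θ in Ioo (-Real.pi) Real.pi, 2624 ^ 2 * hlMax g θ ^ 2 :=
        setLIntegral_mono' measurableSet_Ioo hpt
    _ ≤ ∫⁻ θ, 2624 ^ 2 * hlMax g θ ^ 2 := setLIntegral_le_lintegral _ _
    _ = 2624 ^ 2 * ∫⁻ θ, hlMax g θ ^ 2 := lintegral_const_mul' _ _ (by norm_num)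
    _ ≤ 2624 ^ 2 * (40 * ∫⁻ t, g t ^ 2) := by
        gcongr
        exact lintegral_hlMax_sq_le hgm ENNReal.ofReal_ne_top hB
    _ = _ := by
        rw [hg2, ← mul_assoc, ← mul_assoc]
        congr 1
        rw [ENNReal.ofReal_mul (by norm_num), ENNReal.ofReal_pow (by norm_num)]
        simp only [ENNReal.ofReal_ofNat]
        rw [mul_assoc]; norm_num

theorem isOpen_unitDisc : IsOpen unitDisc := isOpen_lt continuous_norm continuous_const

/-- Polar coordinates on the unit disc. -/
theorem setLIntegral_unitDisc_eq_polar (F : ℂ → ENNReal) :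
    ∫⁻ z in unitDisc, F z = ∫⁻ x in Ioo (0 : ℝ) 1 ×ˢ Ioo (-Real.pi) Real.pi,
      ENNReal.ofReal x.1 * F (circleMap 0 x.1 x.2) := by
  have hms : MeasurableSet (Ioo (0 : ℝ) 1 ×ˢ Ioo (-Real.pi) Real.pi) :=
    measurableSet_Ioo.prod measurableSet_Ioo
  have hsub : Ioo (0 : ℝ) 1 ×ˢ Ioo (-Real.pi) Real.pi ⊆ polarCoord.target :=
    fun x hx => ⟨hx.1.1, hx.2⟩
  rw [← lintegral_indicator isOpen_unitDisc.measurableSet, ← Complex.lintegral_comp_polarCoord_symm,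
    ← inter_eq_self_of_subset_left hsub, ← setLIntegral_indicator hms]
  refine setLIntegral_congr_fun polarCoord.open_target.measurableSet fun x hx => ?_
  have hx1 : 0 < x.1 := hx.1
  have hz : Complex.polarCoord.symm x = circleMap 0 x.1 x.2 := by
    rw [Complex.polarCoord_symm_apply, circleMap_zero, Complex.exp_mul_I]
    push_cast
    rfl
  have hiff : circleMap 0 x.1 x.2 ∈ unitDisc ↔ x ∈ Ioo (0 : ℝ) 1 ×ˢ Ioo (-Real.pi) Real.pi := by
    change ‖circleMap 0 x.1 x.2‖ < 1 ↔ _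
    rw [norm_circleMap_zero, abs_of_pos hx1]
    exact ⟨fun h => ⟨⟨hx1, h⟩, hx.2⟩, fun h => h.1.2⟩
  simp only [hz, smul_eq_mul]
  by_cases h : x ∈ Ioo (0 : ℝ) 1 ×ˢ Ioo (-Real.pi) Real.pi
  · rw [indicator_of_mem h, indicator_of_mem (hiff.2 h)]
  · rw [indicator_of_notMem h, indicator_of_notMem (mt hiff.1 h), mul_zero]

theorem ofReal_norm_le_NTmax {f : ℂ → ℂ} (hf : ContinuousOn f unitDisc) {u : ℂ}
    (hu : u ∈ unitDisc) : ENNReal.ofReal ‖f u‖ ≤ NTmax f u := by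
  rcases eq_or_ne u 0 with rfl | h0
  · exact le_iSup₂_of_le (0 : ℂ) ⟨hu, by simp⟩ le_rfl
  have hmem : ∀ s ∈ Ioo (0 : ℝ) 1, (s : ℂ) * u ∈ Gamma u := by
    intro s hs
    have hn : ‖(s : ℂ) * u‖ = s * ‖u‖ := by
      rw [norm_mul, Complex.norm_real, Real.norm_of_nonneg hs.1.le]
    refine ⟨?_, ?_⟩
    · change ‖(s : ℂ) * u‖ < 1
      rw [hn]
      exact (mul_le_of_le_one_left (norm_nonneg u) hs.2.le).trans_lt hu
    · rw [Complex.arg_real_mul u hs.1, hn, mul_div_cancel_right₀ _ (norm_ne_zero_iff.2 h0), sub_self,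
        abs_zero]
      linarith [hs.2]
  have hlim : Tendsto (fun s : ℝ => (s : ℂ) * u) (nhdsWithin 1 (Iio 1)) (nhds u) := by
    have h : Continuous fun s : ℝ => (s : ℂ) * u := by fun_prop
    simpa using (h.tendsto 1).mono_left nhdsWithin_le_nhds
  have hfu : Tendsto f (nhds u) (nhds (f u)) := hf.continuousAt (isOpen_unitDisc.mem_nhds hu)
  refine le_of_tendsto (ENNReal.tendsto_ofReal (hfu.comp hlim).norm) ?_
  filter_upwards [Ioo_mem_nhdsLT (zero_lt_one' ℝ)] with s hs
  exact le_iSup₂_of_le _ (hmem s hs) le_rfl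

theorem stmt12 (p : ℝ) (hp : 0 < p) (ω : ℝ → ℝ) (hω : IsRadialWeight ω) :
    ∃ C : ℝ, 0 < C ∧ ∀ f : ℂ → ℂ, DifferentiableOn ℂ f unitDisc →
      (∫⁻ z in unitDisc, ENNReal.ofReal (‖f z‖ ^ p * ω ‖z‖)) ≤
          (∫⁻ u in unitDisc, (NTmax f u) ^ p * ENNReal.ofReal (ω ‖u‖)) ∧
        (∫⁻ u in unitDisc, (NTmax f u) ^ p * ENNReal.ofReal (ω ‖u‖)) ≤
          ENNReal.ofReal C * ∫⁻ z in unitDisc, ENNReal.ofReal (‖f z‖ ^ p * ω ‖z‖) := by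
  refine ⟨2624 ^ 2 * 80, by norm_num, fun f hf => ⟨?_, ?_⟩⟩
  · refine setLIntegral_mono' isOpen_unitDisc.measurableSet fun z hz => ?_
    rw [ENNReal.ofReal_mul (by positivity), ← ENNReal.ofReal_rpow_of_nonneg (norm_nonneg _) hp.le]
    gcongr
    exact ofReal_norm_le_NTmax hf.continuousOn hz
  have hω1 : AEMeasurable ω (volume.restrict (Ioo (0 : ℝ) 1)) :=
    (hω.2.mono_set Ioo_subset_Ico_self).aestronglyMeasurable.aemeasurable
  have hfc : ContinuousOn (fun x : ℝ × ℝ => ‖f (circleMap 0 x.1 x.2)‖ ^ p)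
      (Ioo (0 : ℝ) 1 ×ˢ Ioo (-Real.pi) Real.pi) := by
    have hc : Continuous fun x : ℝ × ℝ => circleMap 0 x.1 x.2 := by
      unfold circleMap
      fun_prop
    refine ((hf.continuousOn.comp hc.continuousOn fun x hx => ?_).norm).rpow_const
      fun _ _ => .inr hp.le
    change ‖circleMap 0 x.1 x.2‖ < 1
    rw [norm_circleMap_zero, abs_of_pos hx.1.1]
    exact hx.1.2
  have hprod : (volume : Measure (ℝ × ℝ)).restrict (Ioo (0 : ℝ) 1 ×ˢ Ioo (-Real.pi) Real.pi) =
      (volume.restrict (Ioo (0 : ℝ) 1)).prod (volume.restrict (Ioo (-Real.pi) Real.pi)) := by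
    rw [Measure.prod_restrict, Measure.volume_eq_prod]
  have hmeas : AEMeasurable (fun x : ℝ × ℝ => ENNReal.ofReal x.1 *
      ENNReal.ofReal (‖f (circleMap 0 x.1 x.2)‖ ^ p * ω ‖circleMap 0 x.1 x.2‖))
      ((volume.restrict (Ioo (0 : ℝ) 1)).prod (volume.restrict (Ioo (-Real.pi) Real.pi))) := by
    have h1 := hfc.aemeasurable (μ := volume) (measurableSet_Ioo.prod measurableSet_Ioo)
    rw [hprod] at h1
    have h2 : AEMeasurable (fun x : ℝ × ℝ => ω ‖circleMap 0 x.1 x.2‖)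
        ((volume.restrict (Ioo (0 : ℝ) 1)).prod (volume.restrict (Ioo (-Real.pi) Real.pi))) := by
      refine (hω1.comp_fst (ν := volume.restrict (Ioo (-Real.pi) Real.pi))).congr ?_
      rw [← hprod]
      filter_upwards [ae_restrict_mem (measurableSet_Ioo.prod measurableSet_Ioo)] with x hx
      rw [norm_circleMap_zero, abs_of_pos hx.1.1]
    exact measurable_fst.ennreal_ofReal.aemeasurable.mul (h1.mul h2).ennreal_ofReal
  rw [setLIntegral_unitDisc_eq_polar, setLIntegral_unitDisc_eq_polar, hprod, lintegral_prod _ hmeas,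
    ← lintegral_const_mul' _ _ ENNReal.ofReal_ne_top]
  refine (lintegral_prod_le _).trans (setLIntegral_mono' measurableSet_Ioo fun r hr => ?_)
  have hn (θ : ℝ) : ‖circleMap 0 r θ‖ = r := by rw [norm_circleMap_zero, abs_of_pos hr.1]
  have hsplit (θ : ℝ) : ENNReal.ofReal (‖f (circleMap 0 r θ)‖ ^ p * ω r) =
      ENNReal.ofReal (‖f (circleMap 0 r θ)‖ ^ p) * ENNReal.ofReal (ω r) :=
    ENNReal.ofReal_mul (by positivity)
  simp only [hn, hsplit]
  rw [lintegral_const_mul' _ _ ENNReal.ofReal_ne_top, lintegral_const_mul' _ _ ENNReal.ofReal_ne_top,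
    lintegral_mul_const' _ _ ENNReal.ofReal_ne_top, lintegral_mul_const' _ _ ENNReal.ofReal_ne_top,
    mul_left_comm (ENNReal.ofReal (2624 ^ 2 * 80)), ← mul_assoc (ENNReal.ofReal (2624 ^ 2 * 80))]
  gcongr
  exact lintegral_NTmax_circle_le hp hr.1 hr.2 hf
end
end

section
/- Let 0 < p < ∞ and let ω be a radial weight on the unit disc. Let f ∈ A^p_ω with f(0) ≠ 0, and let {z_k} be the zero sequence of f, repeated according to multiplicity and ordered by increasing moduli. Then ∏_{k=1}^n (1/|z_k|) = o( (∫_{1−1/n}^1 ω(r) dr)^{−1/p} ) as n → ∞; equivalently, lim_{n→∞} (∏_{k=1}^n 1/|z_k|) · (∫_{1−1/n}^1 ω(r) dr)^{1/p} = 0. -/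
open MeasureTheory Set Filter

noncomputable section

open Metric in
lemma log_norm_le_circleAverage_log_norm {g : ℂ → ℂ} {r : ℝ} (hr : 0 < r)
    (hg : AnalyticOnNhd ℂ g (closedBall 0 r)) (h0 : g 0 ≠ 0) :
    Real.log ‖g 0‖ ≤ Real.circleAverage (fun z => Real.log ‖g z‖) 0 r := by
  have hz : (0 : ℂ) ∈ closedBall (0 : ℂ) |r| := by simp
  rw [← abs_of_pos hr] at hg
  rw [MeromorphicOn.circleAverage_log_norm hr.ne' hg.meromorphicOn,
    (hg 0 hz).meromorphicTrailingCoeffAt_of_ne_zero h0]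
  have hd : MeromorphicOn.divisor g (closedBall 0 |r|) 0 = 0 := by
    rw [MeromorphicOn.divisor_apply hg.meromorphicOn hz,
      (hg 0 hz).meromorphicNFAt.meromorphicOrderAt_eq_zero_iff.2 h0]
    rfl
  rw [hd]
  have hs : 0 ≤ ∑ᶠ u, MeromorphicOn.divisor g (closedBall 0 |r|) u *
      Real.log (r * ‖(0 : ℂ) - u‖⁻¹) := by
    refine finsum_nonneg fun u => ?_
    by_cases hu : u ∈ closedBall (0 : ℂ) |r|
    · refine mul_nonneg (by exact_mod_cast MeromorphicOn.AnalyticOnNhd.divisor_nonneg hg u) ?_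
      rcases eq_or_ne u 0 with rfl | hu0
      · simp
      · refine Real.log_nonneg ?_
        have h1 : ‖u‖ ≤ r := by simpa [abs_of_pos hr] using hu
        have h2 : 0 < ‖u‖ := norm_pos_iff.2 hu0
        rw [zero_sub, norm_neg, ← div_eq_mul_inv, one_le_div h2]
        exact h1
    · rw [(MeromorphicOn.divisor g (closedBall 0 |r|)).apply_eq_zero_of_notMem hu]
      simp
  simpa using hs

open Metric in
lemma AnalyticOnNhd.eventually_codiscreteWithin_sphere_ne_zero {f : ℂ → ℂ} {r : ℝ} (hr : 0 < r)
    (hf : AnalyticOnNhd ℂ f (closedBall 0 r)) (h0 : f 0 ≠ 0) :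
    ∀ᶠ z in codiscreteWithin (sphere (0 : ℂ) |r|), f z ≠ 0 := by
  rcases hf.eqOn_zero_or_eventually_ne_zero_of_preconnected
    (convex_closedBall (0 : ℂ) r).isPreconnected with h | h
  · exact absurd (h (mem_closedBall_self hr.le)) h0
  · rw [abs_of_pos hr]
    exact codiscreteWithin_mono sphere_subset_closedBall h

open Metric in
lemma exp_circleAverage_log_norm_le {f : ℂ → ℂ} {r p : ℝ} (hr : 0 < r) (hp : 0 < p)
    (hf : AnalyticOnNhd ℂ f (closedBall 0 r)) (h0 : f 0 ≠ 0) :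
    Real.exp (p * Real.circleAverage (fun z => Real.log ‖f z‖) 0 r) ≤
      Real.circleAverage (fun z => ‖f z‖ ^ p) 0 r := by
  have hfs : AnalyticOnNhd ℂ f (sphere 0 |r|) := by
    rw [abs_of_pos hr]; exact hf.mono sphere_subset_closedBall
  have hint : CircleIntegrable (fun z => p * Real.log ‖f z‖) 0 r :=
    IntervalIntegrable.const_mul hfs.meromorphicOn.circleIntegrable_log_norm p
  have hcongr : (fun z => ‖f z‖ ^ p) =ᶠ[codiscreteWithin (sphere (0 : ℂ) |r|)]
      fun z => Real.exp (p * Real.log ‖f z‖) := by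
    filter_upwards [hf.eventually_codiscreteWithin_sphere_ne_zero hr h0] with z hz
    rw [Real.rpow_def_of_pos (norm_pos_iff.2 hz), mul_comm]
  have hint' : CircleIntegrable (fun z => ‖f z‖ ^ p) 0 r := by
    refine ContinuousOn.circleIntegrable' ?_
    exact hfs.continuousOn.norm.rpow_const fun _ _ => Or.inr hp.le
  rw [Real.circleAverage_congr_codiscreteWithin hcongr hr.ne']
  have hint2 := hint'.congr_codiscreteWithin hcongr
  have hmul : p * Real.circleAverage (fun z => Real.log ‖f z‖) 0 r =
      Real.circleAverage (fun z => p * Real.log ‖f z‖) 0 r :=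
    (Real.circleAverage_fun_smul (a := p) (f := fun z => Real.log ‖f z‖)).symm
  rw [hmul, Real.circleAverage_eq_intervalAverage, Real.circleAverage_eq_intervalAverage]
  rw [CircleIntegrable, intervalIntegrable_iff] at hint hint2
  refine convexOn_exp.map_set_average_le Real.continuous_exp.continuousOn isClosed_univ ?_ ?_
    (by simp) hint hint2
  · simp [Real.pi_pos.ne']
  · simp [ENNReal.mul_eq_top]

open Metric in
lemma log_norm_add_sum_le_circleAverage {f g : ℂ → ℂ} {r : ℝ} (hr : 0 < r) {ι : Type*}
    (s : Finset ι) (Z : ι → ℂ) (hg : AnalyticOnNhd ℂ g (closedBall 0 r))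
    (hf : AnalyticOnNhd ℂ f (closedBall 0 r))
    (h0 : f 0 ≠ 0) (hfg : ∀ z ∈ closedBall (0 : ℂ) r, f z = (∏ k ∈ s, (z - Z k)) * g z) :
    Real.log ‖f 0‖ + ∑ k ∈ s, (Real.log r - Real.log ‖Z k‖) ≤
      Real.circleAverage (fun z => Real.log ‖f z‖) 0 r := by
  have hgs : AnalyticOnNhd ℂ g (sphere 0 |r|) := by
    rw [abs_of_pos hr]; exact hg.mono sphere_subset_closedBall
  have hf0 := hfg 0 (mem_closedBall_self hr.le)
  have hne := h0
  rw [hf0, mul_ne_zero_iff, Finset.prod_ne_zero_iff] at hne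
  have key : Real.circleAverage (fun z => Real.log ‖f z‖) 0 r =
      (∑ k ∈ s, Real.circleAverage (fun z => Real.log ‖z - Z k‖) 0 r) +
        Real.circleAverage (fun z => Real.log ‖g z‖) 0 r := by
    rw [← Real.circleAverage_fun_sum (fun k _ => circleIntegrable_log_norm_sub_const r),
      ← Real.circleAverage_fun_add
        (CircleIntegrable.fun_sum s fun k _ => circleIntegrable_log_norm_sub_const r)
        hgs.meromorphicOn.circleIntegrable_log_norm]
    refine Real.circleAverage_congr_codiscreteWithin ?_ hr.ne'
    filter_upwards [hf.eventually_codiscreteWithin_sphere_ne_zero hr h0,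
      self_mem_codiscreteWithin _] with z hz hzs
    rw [abs_of_pos hr] at hzs
    have hfz := hfg z (sphere_subset_closedBall hzs)
    rw [hfz, mul_ne_zero_iff, Finset.prod_ne_zero_iff] at hz
    rw [hfz, norm_mul, norm_prod, Real.log_mul, Real.log_prod]
    · exact fun k hk => norm_ne_zero_iff.2 (hz.1 k hk)
    · exact Finset.prod_ne_zero_iff.2 fun k hk => norm_ne_zero_iff.2 (hz.1 k hk)
    · exact norm_ne_zero_iff.2 hz.2
  have hlog : Real.log ‖f 0‖ = ∑ k ∈ s, Real.log ‖Z k‖ + Real.log ‖g 0‖ := by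
    rw [hf0, norm_mul, norm_prod, Real.log_mul, Real.log_prod]
    · simp
    · exact fun k hk => norm_ne_zero_iff.2 (hne.1 k hk)
    · exact Finset.prod_ne_zero_iff.2 fun k hk => norm_ne_zero_iff.2 (hne.1 k hk)
    · exact norm_ne_zero_iff.2 hne.2
  have h1 := log_norm_le_circleAverage_log_norm hr hg hne.2
  have h2 : ∑ k ∈ s, Real.log r ≤
      ∑ k ∈ s, Real.circleAverage (fun z => Real.log ‖z - Z k‖) 0 r := by
    refine Finset.sum_le_sum fun k _ => ?_
    rw [circleAverage_log_norm_sub_const_eq_log_radius_add_posLog hr.ne']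
    linarith [Real.posLog_nonneg (x := r⁻¹ * ‖0 - Z k‖)]
  rw [key, hlog, Finset.sum_sub_distrib]
  linarith

open Metric in
/-- If `f` is divisible by `∏ (z - Z k)`, its `p`-th integral mean over `|z| = r` dominates
`|f 0| ^ p * ∏ (r / |Z k|) ^ p`. -/
lemma norm_rpow_mul_prod_rpow_le_circleAverage {f g : ℂ → ℂ} {r p : ℝ} (hr : 0 < r) (hp : 0 < p)
    {ι : Type*} (s : Finset ι) (Z : ι → ℂ) (hg : AnalyticOnNhd ℂ g (closedBall 0 r))
    (hf : AnalyticOnNhd ℂ f (closedBall 0 r)) (h0 : f 0 ≠ 0) (hZ : ∀ k ∈ s, Z k ≠ 0)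
    (hfg : ∀ z ∈ closedBall (0 : ℂ) r, f z = (∏ k ∈ s, (z - Z k)) * g z) :
    (‖f 0‖ * (r ^ s.card * ∏ k ∈ s, (1 / ‖Z k‖))) ^ p ≤
      Real.circleAverage (fun z => ‖f z‖ ^ p) 0 r := by
  refine le_trans (le_of_eq ?_) (le_trans (Real.exp_le_exp.2 (mul_le_mul_of_nonneg_left
    (log_norm_add_sum_le_circleAverage hr s Z hg hf h0 hfg) hp.le))
    (exp_circleAverage_log_norm_le hr hp hf h0))
  have hf0 : 0 < ‖f 0‖ := norm_pos_iff.2 h0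
  have hP : 0 < ∏ k ∈ s, (1 / ‖Z k‖) :=
    Finset.prod_pos fun k hk => one_div_pos.2 (norm_pos_iff.2 (hZ k hk))
  rw [Real.rpow_def_of_pos (by positivity), mul_comm, Real.log_mul hf0.ne' (by positivity),
    Real.log_mul (by positivity) hP.ne', Real.log_prod fun k hk =>
      (one_div_pos.2 (norm_pos_iff.2 (hZ k hk))).ne']
  simp [Finset.sum_sub_distrib]
  ring_nf
  simp

/-- If the circle averages of `u` are at least `c` on the circles of radius `r ∈ (a, 1)`, then
integrating in polar coordinates bounds the integral of `u z * ω ‖z‖` over the annulus from below. -/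
lemma ofReal_le_setLIntegral_annulus {u : ℂ → ℝ} {ω : ℝ → ℝ} {a c : ℝ} (ha : 0 ≤ a)
    (hω : IsRadialWeight ω) (hu : ContinuousOn u unitDisc) (hu0 : ∀ z, 0 ≤ u z)
    (hc : ∀ r ∈ Ioo a 1, c ≤ Real.circleAverage u 0 r) (hc0 : 0 ≤ c) :
    ENNReal.ofReal (2 * Real.pi * a * c * ∫ r in Ioo a 1, ω r) ≤
      ∫⁻ z in {z : ℂ | a < ‖z‖ ∧ ‖z‖ < 1}, ENNReal.ofReal (u z * ω ‖z‖) := by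
  have hA : MeasurableSet {z : ℂ | a < ‖z‖ ∧ ‖z‖ < 1} :=
    (measurableSet_lt measurable_const measurable_norm).inter
      (measurableSet_lt measurable_norm measurable_const)
  have hsub : Ioo a 1 ⊆ Ico (0 : ℝ) 1 := fun r hr => ⟨ha.trans hr.1.le, hr.2⟩
  have hωi : IntegrableOn ω (Ioo a 1) := hω.2.mono_set hsub
  have hmaps : ∀ r ∈ Ioo a 1, ∀ θ, circleMap 0 r θ ∈ unitDisc := fun r hr θ => by
    simpa [unitDisc, abs_of_nonneg (ha.trans hr.1.le)] using hr.2
  have hcm (p : ℝ × ℝ) : Complex.polarCoord.symm p = circleMap 0 p.1 p.2 := by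
    rw [Complex.polarCoord_symm_apply, circleMap, Complex.exp_mul_I]
    simp
  have hinner : ∀ r ∈ Ioo a 1, ENNReal.ofReal (2 * Real.pi * a * c * ω r) ≤
      ∫⁻ θ in Ioo (-Real.pi) Real.pi,
        ENNReal.ofReal (r * (u (circleMap 0 r θ) * ω r)) := by
    intro r hr
    have hr0 : 0 < r := ha.trans_lt hr.1
    have hωr : 0 < ω r := hω.1 r (hsub hr)
    have hcont : Continuous fun θ => u (circleMap 0 r θ) :=
      hu.comp_continuous (continuous_circleMap 0 r) (hmaps r hr)
    have hint : Integrable (fun θ => r * (u (circleMap 0 r θ) * ω r))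
        (volume.restrict (Ioo (-Real.pi) Real.pi)) :=
      ((hcont.integrableOn_Icc.mono_set Ioo_subset_Icc_self).mul_const (ω r)).const_mul r
    rw [← ofReal_integral_eq_lintegral_ofReal hint
      (Eventually.of_forall fun θ => mul_nonneg hr0.le (mul_nonneg (hu0 _) hωr.le))]
    refine ENNReal.ofReal_le_ofReal ?_
    have hper : Function.Periodic (fun θ => u (circleMap 0 r θ)) (2 * Real.pi) := fun θ => by
      simp [periodic_circleMap 0 r θ]
    have hav : ∫ θ in Ioo (-Real.pi) Real.pi, u (circleMap 0 r θ) =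
        2 * Real.pi * Real.circleAverage u 0 r := by
      rw [← integral_Ioc_eq_integral_Ioo, ← intervalIntegral.integral_of_le
        (by linarith [Real.pi_pos]), Real.circleAverage_def, smul_eq_mul]
      have := hper.intervalIntegral_add_eq (-Real.pi) 0
      rw [show -Real.pi + 2 * Real.pi = Real.pi by ring, zero_add] at this
      rw [this]
      field_simp
    rw [integral_const_mul, integral_mul_const, hav]
    have h1 : a * c ≤ r * Real.circleAverage u 0 r := mul_le_mul hr.1.le (hc r hr) hc0 hr0.le
    nlinarith [mul_le_mul_of_nonneg_right h1 (mul_pos Real.two_pi_pos hωr).le]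
  calc ENNReal.ofReal (2 * Real.pi * a * c * ∫ r in Ioo a 1, ω r)
      = ∫⁻ r in Ioo a 1, ENNReal.ofReal (2 * Real.pi * a * c * ω r) := by
        rw [← integral_const_mul, ofReal_integral_eq_lintegral_ofReal (hωi.const_mul _)]
        filter_upwards [ae_restrict_mem measurableSet_Ioo] with r hr
        have := hω.1 r (hsub hr)
        have := Real.pi_pos
        simp only [Pi.zero_apply]
        positivity
    _ ≤ ∫⁻ r in Ioo a 1, ∫⁻ θ in Ioo (-Real.pi) Real.pi,
          ENNReal.ofReal (r * (u (circleMap 0 r θ) * ω r)) :=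
        setLIntegral_mono' measurableSet_Ioo hinner
    _ = ∫⁻ p in Ioo a 1 ×ˢ Ioo (-Real.pi) Real.pi,
          ENNReal.ofReal (p.1 * (u (circleMap 0 p.1 p.2) * ω p.1)) := by
        have hmu : AEMeasurable (fun p : ℝ × ℝ => u (circleMap 0 p.1 p.2))
            (volume.restrict (Ioo a 1 ×ˢ Ioo (-Real.pi) Real.pi)) := by
          refine ContinuousOn.aemeasurable ?_ (measurableSet_Ioo.prod measurableSet_Ioo)
          exact hu.comp (Real.circleMap.continuous (c := 0)).continuousOn
            fun p hp => hmaps p.1 hp.1 p.2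
        rw [Measure.volume_eq_prod, ← Measure.prod_restrict] at hmu ⊢
        have hmω : AEMeasurable (fun p : ℝ × ℝ => ω p.1)
            ((volume.restrict (Ioo a 1)).prod (volume.restrict (Ioo (-Real.pi) Real.pi))) :=
          hωi.aemeasurable.comp_fst
        rw [lintegral_prod]
        exact (measurable_fst.aemeasurable.mul (hmu.mul hmω)).ennreal_ofReal
    _ ≤ ∫⁻ p in polarCoord.target, ENNReal.ofReal p.1 •
          ({z : ℂ | a < ‖z‖ ∧ ‖z‖ < 1}.indicator (fun z => ENNReal.ofReal (u z * ω ‖z‖)))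
            (Complex.polarCoord.symm p) := by
        refine le_trans (le_of_eq ?_) (lintegral_mono_set (s := Ioo a 1 ×ˢ Ioo (-Real.pi) Real.pi) ?_)
        · refine setLIntegral_congr_fun (measurableSet_Ioo.prod measurableSet_Ioo) fun p hp => ?_
          have hp0 : 0 < p.1 := ha.trans_lt hp.1.1
          have hn : ‖circleMap 0 p.1 p.2‖ = p.1 := by simp [abs_of_pos hp0]
          simp only [hcm]
          rw [indicator_of_mem (by rw [mem_ofPred_eq, hn]; exact hp.1), hn, smul_eq_mul,
            ENNReal.ofReal_mul hp0.le]
        · exact prod_mono (fun r hr => ha.trans_lt hr.1) subset_rfl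
    _ = _ := by
        rw [Complex.lintegral_comp_polarCoord_symm, lintegral_indicator hA]

lemma exp_neg_two_le_one_sub_one_div_pow {n : ℕ} (hn : 1 ≤ n) :
    Real.exp (-2) ≤ (1 - 1 / ((n + 1 : ℕ) : ℝ)) ^ (n + 1) := by
  have hn' : (1 : ℝ) ≤ n := by exact_mod_cast hn
  have ha : 0 < 1 - 1 / ((n + 1 : ℕ) : ℝ) := by
    rw [sub_pos, div_lt_one (by positivity)]; push_cast; linarith
  have hlog := Real.one_sub_inv_le_log_of_pos ha
  rw [← Real.log_le_log_iff (Real.exp_pos _) (pow_pos ha _), Real.log_exp, Real.log_pow]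
  have h1 : 1 - (1 - 1 / ((n + 1 : ℕ) : ℝ))⁻¹ = -(1 / n) := by
    push_cast
    have : (n : ℝ) + 1 - 1 ≠ 0 := by linarith
    field_simp
    ring
  rw [h1] at hlog
  have h2 : (n : ℝ) * (1 / n) = 1 := by field_simp
  have h3 : 1 / (n : ℝ) ≤ 1 := by rw [div_le_one (by linarith)]; exact hn'
  push_cast at hlog ⊢
  nlinarith [mul_le_mul_of_nonneg_left hlog (by linarith : (0 : ℝ) ≤ n + 1)]

lemma tendsto_setIntegral_annulus {G : ℂ → ℝ} (hG : IntegrableOn G unitDisc) :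
    Tendsto (fun n : ℕ => ∫ z in {z : ℂ | 1 - 1 / ((n + 1 : ℕ) : ℝ) < ‖z‖ ∧ ‖z‖ < 1}, G z)
      atTop (nhds 0) := by
  have h := tendsto_setIntegral_of_antitone (f := G) (μ := volume)
    (s := fun n : ℕ => {z : ℂ | 1 - 1 / ((n + 1 : ℕ) : ℝ) < ‖z‖ ∧ ‖z‖ < 1})
    (fun n => (measurableSet_lt measurable_const measurable_norm).inter
      (measurableSet_lt measurable_norm measurable_const))
    (fun m n hmn z hz => by
      have : (1 : ℝ) / ((n + 1 : ℕ) : ℝ) ≤ 1 / ((m + 1 : ℕ) : ℝ) := by gcongr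
      exact ⟨by linarith [hz.1], hz.2⟩)
    ⟨0, hG.mono_set fun z hz => hz.2⟩
  have he : ⋂ n : ℕ, {z : ℂ | 1 - 1 / ((n + 1 : ℕ) : ℝ) < ‖z‖ ∧ ‖z‖ < 1} = ∅ := by
    refine eq_empty_of_forall_notMem fun z hz => ?_
    rw [mem_iInter] at hz
    obtain ⟨n, hn⟩ := exists_nat_one_div_lt (sub_pos.2 (hz 0).2)
    have := (hz n).1
    push_cast at this
    linarith
  rwa [he, setIntegral_empty] at h

theorem stmt15 (p : ℝ) (hp : 0 < p) (ω : ℝ → ℝ) (hω : IsRadialWeight ω)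
    (f : ℂ → ℂ) (hf : DifferentiableOn ℂ f unitDisc)
    (hfin : IntegrableOn (fun z => ‖f z‖ ^ p * ω ‖z‖) unitDisc)
    (h0 : f 0 ≠ 0) (Z : ℕ → ℂ) (hZ : ∀ k, Z k ∈ unitDisc)
    -- ordered by increasing moduli:
    (hmono : ∀ k, ‖Z k‖ ≤ ‖Z (k + 1)‖)
    -- `{Z k}` consists of zeros of `f`, counting multiplicities:
    (hzero : ∀ s : Finset ℕ, ∃ g : ℂ → ℂ, DifferentiableOn ℂ g unitDisc ∧
      ∀ z ∈ unitDisc, f z = (∏ k ∈ s, (z - Z k)) * g z) :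
    Tendsto
      (fun n : ℕ =>
        (∏ k ∈ Finset.range n, (1 / ‖Z k‖)) * (wInt ω (1 - 1 / (n : ℝ))) ^ (1 / p))
      atTop (nhds 0) := by
  have hopen : IsOpen unitDisc := isOpen_lt continuous_norm continuous_const
  have hdisc : ∀ r < 1, Metric.closedBall (0 : ℂ) r ⊆ unitDisc := fun r hr z hz =>
    (mem_closedBall_zero_iff.1 hz).trans_lt hr
  have hZ0 : ∀ k, Z k ≠ 0 := by
    intro k hk
    obtain ⟨g, -, hg⟩ := hzero {k}
    exact h0 (by simp [hg 0 (by simp [unitDisc]), hk])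
  have hf0 : 0 < ‖f 0‖ := norm_pos_iff.2 h0
  set K : ℝ := Real.pi * (‖f 0‖ * Real.exp (-2)) ^ p with hK
  have hKpos : 0 < K := by positivity
  set I : ℕ → ℝ := fun n =>
    ∫ z in {z : ℂ | 1 - 1 / ((n + 1 : ℕ) : ℝ) < ‖z‖ ∧ ‖z‖ < 1}, ‖f z‖ ^ p * ω ‖z‖ with hI
  have hIlim : Tendsto I atTop (nhds 0) := tendsto_setIntegral_annulus hfin
  have hP : ∀ n, 0 < ∏ k ∈ Finset.range n, (1 / ‖Z k‖) := fun n =>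
    Finset.prod_pos fun k _ => one_div_pos.2 (norm_pos_iff.2 (hZ0 k))
  have hW : ∀ n : ℕ, wInt ω (1 - 1 / ((n + 1 : ℕ) : ℝ)) =
      ∫ r in Ioo (1 - 1 / ((n + 1 : ℕ) : ℝ)) 1, ω r := fun n => by
    rw [wInt, intervalIntegral.integral_of_le (sub_le_self _ (by positivity)),
      integral_Ioc_eq_integral_Ioo]
  have ha0 : ∀ n : ℕ, 0 ≤ 1 - 1 / ((n + 1 : ℕ) : ℝ) := fun n => by
    rw [sub_nonneg, div_le_one (by positivity)]; push_cast; linarith [n.cast_nonneg (α := ℝ)]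
  have hWnn : ∀ n : ℕ, 0 ≤ wInt ω (1 - 1 / ((n + 1 : ℕ) : ℝ)) := fun n => by
    rw [hW]
    exact setIntegral_nonneg measurableSet_Ioo fun r hr =>
      (hω.1 r ⟨(ha0 n).trans hr.1.le, hr.2⟩).le
  have hbound : ∀ n : ℕ, 1 ≤ n →
      K * ((∏ k ∈ Finset.range (n + 1), (1 / ‖Z k‖)) ^ p *
        wInt ω (1 - 1 / ((n + 1 : ℕ) : ℝ))) ≤ I n := by
    intro n hn
    have hpow := exp_neg_two_le_one_sub_one_div_pow hn
    set a : ℝ := 1 - 1 / ((n + 1 : ℕ) : ℝ) with ha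
    set P := ∏ k ∈ Finset.range (n + 1), (1 / ‖Z k‖)
    have hPpos : 0 < P := hP (n + 1)
    have ha2 : 1 ≤ 2 * a := by
      have : 1 / ((n + 1 : ℕ) : ℝ) ≤ 1 / 2 :=
        one_div_le_one_div_of_le two_pos (by exact_mod_cast Nat.succ_le_succ hn)
      linarith
    obtain ⟨g, hg, hfg⟩ := hzero (Finset.range (n + 1))
    have hc : ∀ r ∈ Ioo a 1, (‖f 0‖ * (Real.exp (-2) * P)) ^ p ≤
        Real.circleAverage (fun z => ‖f z‖ ^ p) 0 r := by
      intro r hr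
      have hr0 : 0 < r := (ha0 n).trans_lt hr.1
      refine le_trans ?_ (norm_rpow_mul_prod_rpow_le_circleAverage hr0 hp (Finset.range (n + 1)) Z
        ((hg.analyticOnNhd hopen).mono (hdisc r hr.2))
        ((hf.analyticOnNhd hopen).mono (hdisc r hr.2)) h0 (fun k _ => hZ0 k)
        fun z hz => hfg z (hdisc r hr.2 hz))
      rw [Finset.card_range]
      have : Real.exp (-2) ≤ r ^ (n + 1) :=
        hpow.trans (pow_le_pow_left₀ (ha0 n) hr.1.le _)
      gcongr
    have hmain := ofReal_le_setLIntegral_annulus (ha0 n) hω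
      (hf.continuousOn.norm.rpow_const fun _ _ => Or.inr hp.le)
      (fun z => Real.rpow_nonneg (norm_nonneg (f z)) p) hc (by positivity)
    have hnn : ∀ z ∈ {z : ℂ | a < ‖z‖ ∧ ‖z‖ < 1}, 0 ≤ ‖f z‖ ^ p * ω ‖z‖ := fun z hz =>
      mul_nonneg (by positivity) (hω.1 _ ⟨norm_nonneg z, hz.2⟩).le
    have hA : MeasurableSet {z : ℂ | a < ‖z‖ ∧ ‖z‖ < 1} :=
      (measurableSet_lt measurable_const measurable_norm).inter
        (measurableSet_lt measurable_norm measurable_const)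
    rw [← ofReal_integral_eq_lintegral_ofReal (hfin.mono_set fun z hz => hz.2)
      ((ae_restrict_iff' hA).2 (Eventually.of_forall hnn)),
      ENNReal.ofReal_le_ofReal_iff (setIntegral_nonneg hA hnn), ← hW] at hmain
    refine le_trans ?_ hmain
    rw [hK, ← mul_assoc ‖f 0‖, Real.mul_rpow (by positivity) hPpos.le]
    have hX : 0 ≤ Real.pi * (‖f 0‖ * Real.exp (-2)) ^ p * (P ^ p * wInt ω a) :=
      mul_nonneg hKpos.le (mul_nonneg (by positivity) (hWnn n))
    nlinarith [mul_le_mul_of_nonneg_right ha2 hX]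
  rw [← tendsto_add_atTop_iff_nat 1]
  have hlim : Tendsto (fun n => (I n / K) ^ (1 / p)) atTop (nhds 0) := by
    have := (hIlim.div_const K).rpow_const (p := 1 / p) (Or.inr (by positivity))
    rwa [zero_div, Real.zero_rpow (by positivity)] at this
  refine squeeze_zero' (Eventually.of_forall fun n => ?_) ?_ hlim
  · exact mul_nonneg (hP _).le (Real.rpow_nonneg (hWnn n) _)
  · filter_upwards [eventually_ge_atTop 1] with n hn
    have hPn := (hP (n + 1)).le
    calc _ = ((∏ k ∈ Finset.range (n + 1), (1 / ‖Z k‖)) ^ p *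
          wInt ω (1 - 1 / ((n + 1 : ℕ) : ℝ))) ^ (1 / p) := by
          rw [Real.mul_rpow (by positivity) (hWnn n), ← Real.rpow_mul hPn,
            mul_one_div_cancel hp.ne', Real.rpow_one]
      _ ≤ (I n / K) ^ (1 / p) := by
          refine Real.rpow_le_rpow (mul_nonneg (by positivity) (hWnn n)) ?_ (by positivity)
          rw [le_div_iff₀ hKpos, mul_comm]
          exact hbound n hn
end
end
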